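/- arXiv:2009.02783 — 6 statements merged into one kernel-verified Lean document; each statement's English description precedes it below -/
import Mathlib

section
/- Let H = (X,Y,E) be a complete bipartite r-uniform hypergraph on n vertices (n = |X| + |Y|, n ≥ 3) with 3 ≤ r ≤ n. Then the total domatic number of H equals ⌊n/2⌋, i.e., d_t(H) = ⌊n/2⌋. -/
open Finset

/-- Two vertices of a hypergraph with edge set `E` are adjacent if they are distinct
and some hyperedge contains both of them. -/
def HypVAdj {V : Type*} (E : Finset (Finset V)) (x y : V) : Prop :=
  x ≠ y ∧ ∃ e ∈ E, x ∈ e ∧ y ∈ e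

/-- A dominating set: every vertex outside `D` is adjacent to some vertex of `D`. -/
def IsDominatingSet {V : Type*} (E : Finset (Finset V)) (D : Finset V) : Prop :=
  ∀ x : V, x ∉ D → ∃ y ∈ D, HypVAdj E x y

/-- A total dominating set: every vertex is adjacent to some vertex of `D`. -/
def IsTotalDominatingSet {V : Type*} (E : Finset (Finset V)) (D : Finset V) : Prop :=
  ∀ x : V, ∃ y ∈ D, HypVAdj E x y

/-- A partition of the full vertex set into `k` dominating sets. -/
def IsDomaticPartition {V : Type*} [Fintype V] [DecidableEq V] (E : Finset (Finset V))
    {k : ℕ} (C : Fin k → Finset V) : Prop :=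
  (∀ i j : Fin k, i ≠ j → Disjoint (C i) (C j)) ∧
  (Finset.univ.biUnion C = Finset.univ) ∧
  (∀ i, IsDominatingSet E (C i))

/-- A partition of the full vertex set into `k` total dominating sets. -/
def IsTotalDomaticPartition {V : Type*} [Fintype V] [DecidableEq V] (E : Finset (Finset V))
    {k : ℕ} (C : Fin k → Finset V) : Prop :=
  (∀ i j : Fin k, i ≠ j → Disjoint (C i) (C j)) ∧
  (Finset.univ.biUnion C = Finset.univ) ∧
  (∀ i, IsTotalDominatingSet E (C i))

/-- Two hyperedges are adjacent if they are distinct and share at least one vertex. -/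
def HypEAdj {V : Type*} [DecidableEq V] (e f : Finset V) : Prop :=
  e ≠ f ∧ (e ∩ f).Nonempty

/-- An edge-dominating set: a subset `F ⊆ E` such that every hyperedge not in `F`
is adjacent to some hyperedge of `F`. -/
def IsEdgeDominatingSet {V : Type*} [DecidableEq V] (E F : Finset (Finset V)) : Prop :=
  F ⊆ E ∧ ∀ e ∈ E, e ∉ F → ∃ f ∈ F, HypEAdj e f

/-- A total edge-dominating set: a subset `F ⊆ E` such that every hyperedge of `E`
is adjacent to some hyperedge of `F`. -/
def IsTotalEdgeDominatingSet {V : Type*} [DecidableEq V] (E F : Finset (Finset V)) : Prop :=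
  F ⊆ E ∧ ∀ e ∈ E, ∃ f ∈ F, HypEAdj e f

/-- A partition of the edge set `E` into `k` edge-dominating sets. -/
def IsEdgeDomaticPartition {V : Type*} [DecidableEq V] (E : Finset (Finset V))
    {k : ℕ} (C : Fin k → Finset (Finset V)) : Prop :=
  (∀ i j : Fin k, i ≠ j → Disjoint (C i) (C j)) ∧
  (Finset.univ.biUnion C = E) ∧
  (∀ i, IsEdgeDominatingSet E (C i))

/-- A partition of the edge set `E` into `k` total edge-dominating sets. -/
def IsTotalEdgeDomaticPartition {V : Type*} [DecidableEq V] (E : Finset (Finset V))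
    {k : ℕ} (C : Fin k → Finset (Finset V)) : Prop :=
  (∀ i j : Fin k, i ≠ j → Disjoint (C i) (C j)) ∧
  (Finset.univ.biUnion C = E) ∧
  (∀ i, IsTotalEdgeDominatingSet E (C i))

/-- Edge set of the complete `r`-uniform hypergraph on the vertex type `V`:
all `r`-element subsets of `V`. -/
def completeEdges (V : Type*) [Fintype V] [DecidableEq V] (r : ℕ) : Finset (Finset V) :=
  Finset.powersetCard r (Finset.univ : Finset V)

/-- Edge set of the complete bipartite `r`-uniform hypergraph with parts `X` and `Y`:
all `r`-element subsets of `X ∪ Y` meeting both `X` and `Y`. -/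
def bipEdges {V : Type*} [DecidableEq V] (X Y : Finset V) (r : ℕ) : Finset (Finset V) :=
  (Finset.powersetCard r (X ∪ Y)).filter fun e => (e ∩ X).Nonempty ∧ (e ∩ Y).Nonempty

/-- In a complete bipartite `r`-uniform hypergraph with `3 ≤ r`, any two distinct vertices are
adjacent. -/
theorem hypVAdj_bipEdges {V : Type*} [DecidableEq V] {X Y : Finset V} {r : ℕ}
    (hX : X.Nonempty) (hY : Y.Nonempty) (hr3 : 3 ≤ r) (hr : r ≤ (X ∪ Y).card)
    {x y : V} (hx : x ∈ X ∪ Y) (hy : y ∈ X ∪ Y) (hxy : x ≠ y) :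
    HypVAdj (bipEdges X Y r) x y := by
  obtain ⟨w, hw, hwX, hwY⟩ : ∃ w ∈ X ∪ Y,
      (x ∈ X ∨ y ∈ X ∨ w ∈ X) ∧ (x ∈ Y ∨ y ∈ Y ∨ w ∈ Y) := by
    obtain ⟨a, ha⟩ := hX
    obtain ⟨b, hb⟩ := hY
    by_cases h : x ∈ X ∨ y ∈ X
    · exact ⟨b, mem_union_right _ hb, by tauto, Or.inr (Or.inr hb)⟩
    · rw [mem_union] at hx
      exact ⟨a, mem_union_left _ ha, Or.inr (Or.inr ha), by tauto⟩
  have hsub : ({x, y, w} : Finset V) ⊆ X ∪ Y := by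
    simp only [insert_subset_iff, singleton_subset_iff]
    exact ⟨hx, hy, hw⟩
  obtain ⟨e, hse, he, hcard⟩ :=
    exists_subsuperset_card_eq hsub (card_le_three.trans hr3) hr
  simp only [insert_subset_iff, singleton_subset_iff] at hse
  obtain ⟨hxe, hye, hwe⟩ := hse
  refine ⟨hxy, e, ?_, hxe, hye⟩
  rw [bipEdges, mem_filter, mem_powersetCard]
  refine ⟨⟨he, hcard⟩, ?_, ?_⟩
  · rcases hwX with h | h | h
    exacts [⟨x, mem_inter.2 ⟨hxe, h⟩⟩, ⟨y, mem_inter.2 ⟨hye, h⟩⟩, ⟨w, mem_inter.2 ⟨hwe, h⟩⟩]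
  · rcases hwY with h | h | h
    exacts [⟨x, mem_inter.2 ⟨hxe, h⟩⟩, ⟨y, mem_inter.2 ⟨hye, h⟩⟩, ⟨w, mem_inter.2 ⟨hwe, h⟩⟩]

/-- A total dominating set of a hypergraph with at least one vertex has at least two elements. -/
theorem IsTotalDominatingSet.two_le_card {V : Type*} [Nonempty V] {E : Finset (Finset V)}
    {D : Finset V} (hD : IsTotalDominatingSet E D) : 2 ≤ D.card := by
  obtain ⟨y, hy, -⟩ := hD (Classical.arbitrary V)
  obtain ⟨z, hz, hyz, -⟩ := hD y
  exact one_lt_card.2 ⟨y, hy, z, hz, hyz⟩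

/-- A total domatic partition has at most half as many classes as there are vertices. -/
theorem IsTotalDomaticPartition.le_card_div_two {V : Type*} [Fintype V] [DecidableEq V]
    [Nonempty V] {E : Finset (Finset V)} {k : ℕ} {C : Fin k → Finset V}
    (hC : IsTotalDomaticPartition E C) : k ≤ Fintype.card V / 2 := by
  obtain ⟨hdisj, hcover, hdom⟩ := hC
  have hcard : Fintype.card V = ∑ i, (C i).card := by
    rw [← card_univ, ← hcover, card_biUnion fun i _ j _ hij => hdisj i j hij]
  have hle : ∑ _i : Fin k, 2 ≤ ∑ i, (C i).card :=
    sum_le_sum fun i _ => (hdom i).two_le_card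
  simp only [sum_const, card_univ, Fintype.card_fin, smul_eq_mul] at hle
  omega

/-- If any two distinct vertices are adjacent, then a set with at least two elements is total
dominating. -/
theorem isTotalDominatingSet_of_one_lt_card {V : Type*} {E : Finset (Finset V)}
    (hE : ∀ x y : V, x ≠ y → HypVAdj E x y) {D : Finset V} (hD : 1 < D.card) :
    IsTotalDominatingSet E D := fun x => by
  obtain ⟨y, hy, hyx⟩ := exists_mem_ne hD x
  exact ⟨y, hy, hE x y hyx.symm⟩

/-- If any two distinct vertices are adjacent and there are at least two vertices, then there is
a total domatic partition into `⌊|V| / 2⌋` classes. -/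
theorem exists_isTotalDomaticPartition {V : Type*} [Fintype V] [DecidableEq V]
    {E : Finset (Finset V)} (hE : ∀ x y : V, x ≠ y → HypVAdj E x y)
    (hV : 2 ≤ Fintype.card V) :
    ∃ C : Fin (Fintype.card V / 2) → Finset V, IsTotalDomaticPartition E C := by
  let φ := Fintype.equivFin V
  let f : V → Fin (Fintype.card V / 2) := fun v =>
    ⟨min ((φ v : ℕ) / 2) (Fintype.card V / 2 - 1), by omega⟩
  refine ⟨fun i => univ.filter fun v => f v = i, fun i j hij => ?_, ?_, fun i => ?_⟩
  · rw [disjoint_left]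
    intro v hi hj
    exact hij ((mem_filter.1 hi).2.symm.trans (mem_filter.1 hj).2)
  · ext v
    simp
  · apply isTotalDominatingSet_of_one_lt_card hE
    have hi := i.isLt
    refine one_lt_card.2 ⟨φ.symm ⟨2 * i, by omega⟩, ?_, φ.symm ⟨2 * i + 1, by omega⟩, ?_, ?_⟩
    · simp only [mem_filter, mem_univ, true_and, f, Fin.ext_iff, Equiv.apply_symm_apply]
      omega
    · simp only [mem_filter, mem_univ, true_and, f, Fin.ext_iff, Equiv.apply_symm_apply]
      omega
    · simp [Fin.ext_iff]

/-- the total domatic number of a complete bipartite `r`-uniform hypergraph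
on `n ≥ 3` vertices with `3 ≤ r ≤ n` equals `⌊n/2⌋`. -/
theorem total_domatic_number_complete_bipartite {V : Type*} [Fintype V] [DecidableEq V]
    {X Y : Finset V} {r n : ℕ}
    (hdisj : Disjoint X Y) (hX : X.Nonempty) (hY : Y.Nonempty)
    (hunion : X ∪ Y = (Finset.univ : Finset V))
    (hn : X.card + Y.card = n) (hn3 : 3 ≤ n) (hr3 : 3 ≤ r) (hrn : r ≤ n) :
    IsGreatest {k : ℕ | ∃ C : Fin k → Finset V,
      IsTotalDomaticPartition (bipEdges X Y r) C} (n / 2) := by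
  have hcard : Fintype.card V = n := by
    rw [← hn, ← card_union_of_disjoint hdisj, hunion, card_univ]
  subst hcard
  have : Nonempty V := ⟨hX.choose⟩
  constructor
  · refine exists_isTotalDomaticPartition (fun x y hxy => ?_) (by omega)
    exact hypVAdj_bipEdges hX hY hr3 (by rwa [hunion, card_univ]) (hunion ▸ mem_univ x)
      (hunion ▸ mem_univ y) hxy
  · rintro k ⟨C, hC⟩
    exact hC.le_card_div_two
end

section
/- Let H be the complete r-uniform hypergraph on a finite vertex set V with n vertices, where 1 ≤ r ≤ ⌊n/2⌋ and r divides n. Then the edge-domatic number of H equals C(n,r) divided by n/r, i.e., ed(H) = C(n,r)·r/n. -/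
open Finset

theorem card_filter_mem_eq_of_notMem {V : Type*} [Fintype V] [DecidableEq V] (r : ℕ)
    {T : Finset V} (W : Finset V → Prop) [DecidablePred W] {x y : V} (hx : x ∉ T) (hy : y ∉ T) :
    #{e ∈ completeEdges V r | y ∈ e ∧ W (e ∩ T)} =
      #{e ∈ completeEdges V r | x ∈ e ∧ W (e ∩ T)} := by
  have key : ∀ e : Finset V, e.map (Equiv.swap x y).toEmbedding ∩ T = e ∩ T := by
    intro e
    ext z
    simp only [mem_inter, mem_map_equiv, Equiv.symm_swap]
    refine and_congr_left fun hz => ?_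
    rw [Equiv.swap_apply_of_ne_of_ne]
    · rintro rfl; exact hx hz
    · rintro rfl; exact hy hz
  have invol : ∀ e : Finset V,
      (e.map (Equiv.swap x y).toEmbedding).map (Equiv.swap x y).toEmbedding = e := by
    intro e
    ext z
    simp [mem_map_equiv]
  refine card_bij' (fun e _ => e.map (Equiv.swap x y).toEmbedding)
    (fun e _ => e.map (Equiv.swap x y).toEmbedding) ?_ ?_ (fun e _ => invol e) (fun e _ => invol e)
  · intro e he
    simp only [completeEdges, mem_filter, mem_powersetCard_univ] at he ⊢
    refine ⟨by simpa using he.1, by simpa [mem_map_equiv] using he.2.1, ?_⟩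
    rw [key]; exact he.2.2
  · intro e he
    simp only [completeEdges, mem_filter, mem_powersetCard_univ] at he ⊢
    refine ⟨by simpa using he.1, by simpa [mem_map_equiv] using he.2.1, ?_⟩
    rw [key]; exact he.2.2

theorem sum_sub_card_inter_eq {V : Type*} [Fintype V] [DecidableEq V] (r : ℕ)
    {T : Finset V} (W : Finset V → Prop) [DecidablePred W] {x : V} (hx : x ∉ T) :
    ∑ e ∈ completeEdges V r, (if W (e ∩ T) then r - #(e ∩ T) else 0) =
      #Tᶜ * #{e ∈ completeEdges V r | x ∈ e ∧ W (e ∩ T)} := by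
  have h1 : ∀ e ∈ completeEdges V r, (if W (e ∩ T) then r - #(e ∩ T) else 0) =
      ∑ y ∈ Tᶜ, if y ∈ e ∧ W (e ∩ T) then 1 else 0 := by
    intro e he
    have hr : #e = r := by simpa [completeEdges] using he
    split_ifs with hW
    · simp only [hW, and_true]
      rw [← card_filter, ← hr, ← card_sdiff_add_card_inter e T, Nat.add_sub_cancel]
      congr 1
      ext z
      simp [and_comm]
    · simp [hW]
  rw [sum_congr rfl h1, sum_comm]
  simp_rw [← card_filter]
  rw [sum_congr rfl fun y hy => card_filter_mem_eq_of_notMem r W hx (mem_compl.1 hy), sum_const,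
    smul_eq_mul]

/-- The colour classes of `g i`, restricted to `T`, form as a family indexed by `ι × κ` the same
multiset as the traces on `T` of all `r`-element subsets; this is expressed by equality of all
weighted sums. -/
def SameTraces {V ι κ : Type*} [Fintype V] [DecidableEq V] [Fintype ι] [Fintype κ]
    [DecidableEq κ] (r : ℕ) (g : ι → V → κ) (T : Finset V) : Prop :=
  ∀ w : Finset V → ℕ, ∑ i, ∑ j, w {v ∈ T | g i v = j} = ∑ e ∈ completeEdges V r, w (e ∩ T)

section Baranyai

variable {V ι κ : Type*} [Fintype V] [DecidableEq V] [Fintype ι] [Fintype κ]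
  [DecidableEq κ] {r : ℕ} {g : ι → V → κ} {T : Finset V}

theorem SameTraces.card_le (h : SameTraces r g T) (i : ι) (j : κ) :
    #{v ∈ T | g i v = j} ≤ r := by
  have h0 := h fun S => if #S ≤ r then 0 else 1
  rw [sum_eq_zero (s := completeEdges V r)] at h0
  · have := (sum_eq_zero_iff.1 ((sum_eq_zero_iff.1 h0) i (mem_univ i))) j (mem_univ j)
    by_contra hlt
    simp [hlt] at this
  · intro e he
    have hr : #e = r := by simpa [completeEdges] using he
    rw [if_pos]
    exact hr ▸ card_le_card inter_subset_left

theorem SameTraces.sum_sub_card (h : SameTraces r g T)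
    (hV : Fintype.card κ * r = Fintype.card V) (i : ι) :
    ∑ j, (r - #{v ∈ T | g i v = j}) = #Tᶜ := by
  have h1 : ∑ j, (r - #{v ∈ T | g i v = j}) + ∑ j, #{v ∈ T | g i v = j} = Fintype.card V := by
    rw [← sum_add_distrib, sum_congr rfl fun j _ => Nat.sub_add_cancel (h.card_le i j)]
    simpa using hV
  have h2 : #T = ∑ j, #{v ∈ T | g i v = j} :=
    card_eq_sum_card_fiberwise fun _ _ => mem_coe.2 (mem_univ _)
  rw [card_compl]
  omega

/-- The matching step: one colour per index can be chosen so that the chosen classes match the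
traces of the edges through `x`. -/
theorem SameTraces.exists_matching (h : SameTraces r g T)
    (hV : Fintype.card κ * r = Fintype.card V) {x : V} (hx : x ∉ T) :
    ∃ c : ι → κ, ∀ w : Finset V → ℕ, ∑ i, w {v ∈ T | g i v = c i} =
      ∑ e ∈ completeEdges V r with x ∈ e, w (e ∩ T) := by
  classical
  have hpos : 0 < #Tᶜ := card_pos.2 ⟨x, mem_compl.2 hx⟩
  have hW : ∀ (W : Finset V → Prop) [DecidablePred W],
      ∑ i, ∑ j, (if W {v ∈ T | g i v = j} then r - #{v ∈ T | g i v = j} else 0) =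
        #Tᶜ * #{e ∈ completeEdges V r | x ∈ e ∧ W (e ∩ T)} := fun W _ => by
    rw [← sum_sub_card_inter_eq r W hx]
    exact h fun S => if W S then r - #S else 0
  let t : ι → Finset (Finset V) := fun i =>
    {e ∈ completeEdges V r | x ∈ e ∧ ∃ j, {v ∈ T | g i v = j} = e ∩ T}
  obtain ⟨f, hf, hft⟩ := (all_card_le_biUnion_card_iff_exists_injective t).1 (by
    intro A
    have hN : A.biUnion t = {e ∈ completeEdges V r |
        x ∈ e ∧ ∃ i ∈ A, ∃ j, {v ∈ T | g i v = j} = e ∩ T} := by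
      ext e
      simp only [t, mem_biUnion, mem_filter]
      tauto
    refine Nat.le_of_mul_le_mul_left ?_ hpos
    rw [hN, ← hW fun S => ∃ i ∈ A, ∃ j, {v ∈ T | g i v = j} = S, mul_comm, ← smul_eq_mul,
      ← sum_const]
    refine le_trans (sum_le_sum fun i hi => ?_) (sum_le_sum_of_subset (subset_univ A))
    rw [← h.sum_sub_card hV i]
    refine sum_le_sum fun j _ => ?_
    rw [if_pos ⟨i, hi, j, rfl⟩])
  have hcard : Fintype.card ι = #{e ∈ completeEdges V r | x ∈ e} := by
    have h1 := hW fun _ => True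
    simp only [if_true, and_true, h.sum_sub_card hV] at h1
    rw [sum_const, smul_eq_mul, mul_comm, card_univ] at h1
    exact Nat.eq_of_mul_eq_mul_left hpos h1
  have himage : univ.image f = {e ∈ completeEdges V r | x ∈ e} := by
    refine eq_of_subset_of_card_le ?_ ?_
    · intro e he
      obtain ⟨i, -, rfl⟩ := mem_image.1 he
      have := mem_filter.1 (hft i)
      exact mem_filter.2 ⟨this.1, this.2.1⟩
    · rw [card_image_of_injective _ hf, ← hcard, card_univ]
  choose c hc using fun i => (mem_filter.1 (hft i)).2.2
  refine ⟨c, fun w => ?_⟩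
  rw [← himage, sum_image fun a _ b _ hab => hf hab]
  simp_rw [hc]

theorem SameTraces.exists_insert (h : SameTraces r g T)
    (hV : Fintype.card κ * r = Fintype.card V) {x : V} (hx : x ∉ T) :
    ∃ g' : ι → V → κ, SameTraces r g' (insert x T) := by
  obtain ⟨c, hc⟩ := h.exists_matching hV hx
  refine ⟨fun i => Function.update (g i) x (c i), fun w => ?_⟩
  have hpart : ∀ i j, {v ∈ insert x T | Function.update (g i) x (c i) v = j} =
      if c i = j then insert x {v ∈ T | g i v = j} else {v ∈ T | g i v = j} := by
    intro i j
    have hT : {v ∈ T | Function.update (g i) x (c i) v = j} = {v ∈ T | g i v = j} :=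
      filter_congr fun v hv => by
        rw [Function.update_of_ne]
        rintro rfl
        exact hx hv
    rw [filter_insert, hT, Function.update_self]
  have hl : ∀ i, ∑ j, w {v ∈ insert x T | Function.update (g i) x (c i) v = j} +
      w {v ∈ T | g i v = c i} =
      ∑ j, w {v ∈ T | g i v = j} + w (insert x {v ∈ T | g i v = c i}) := by
    intro i
    rw [← add_sum_erase _ _ (mem_univ (c i)), ← add_sum_erase univ (fun j => w {v ∈ T | g i v = j})
      (mem_univ (c i)), hpart, if_pos rfl, sum_congr rfl fun j hj => by
        rw [hpart, if_neg (ne_of_mem_erase hj).symm]]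
    ring
  have hr : ∑ e ∈ completeEdges V r, w (e ∩ insert x T) +
      ∑ e ∈ completeEdges V r with x ∈ e, w (e ∩ T) =
      ∑ e ∈ completeEdges V r, w (e ∩ T) +
        ∑ e ∈ completeEdges V r with x ∈ e, w (insert x (e ∩ T)) := by
    rw [sum_filter, sum_filter, ← sum_add_distrib, ← sum_add_distrib]
    refine sum_congr rfl fun e _ => ?_
    by_cases hxe : x ∈ e
    · simp [hxe, inter_insert_of_mem, add_comm]
    · simp [hxe, inter_insert_of_notMem]
  have hsum := sum_congr (rfl : (univ : Finset ι) = univ) fun i _ => hl i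
  rw [sum_add_distrib, sum_add_distrib, h w, hc w, hc fun S => w (insert x S)] at hsum
  beta_reduce
  omega

theorem SameTraces.empty (hcard : Fintype.card ι * Fintype.card κ = (Fintype.card V).choose r)
    (g : ι → V → κ) : SameTraces r g ∅ := by
  intro w
  simp [completeEdges, ← hcard, mul_assoc]

/-- **Baranyai's theorem**, as a family of vertex colourings. -/
theorem exists_sameTraces_univ [Nonempty κ] (hV : Fintype.card κ * r = Fintype.card V)
    (hcard : Fintype.card ι * Fintype.card κ = (Fintype.card V).choose r) :
    ∃ g : ι → V → κ, SameTraces r g univ := by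
  suffices ∀ T : Finset V, ∃ g : ι → V → κ, SameTraces r g T from this univ
  intro T
  induction T using Finset.induction_on with
  | empty => exact ⟨fun _ _ => Classical.arbitrary κ, .empty hcard _⟩
  | insert x T hx ih =>
    obtain ⟨g, hg⟩ := ih
    exact hg.exists_insert hV hx

theorem SameTraces.card_filter_eq_one (h : SameTraces r g univ) {e : Finset V}
    (he : e ∈ completeEdges V r) : #{p : ι × κ | ({v | g p.1 v = p.2} : Finset V) = e} = 1 := by
  have := h fun S => if S = e then 1 else 0
  rw [← Fintype.sum_prod_type' fun i j => if ({v | g i v = j} : Finset V) = e then 1 else 0,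
    ← card_filter] at this
  rw [this]
  simp [he]

theorem SameTraces.mem_completeEdges (h : SameTraces r g univ) (i : ι) (j : κ) :
    ({v | g i v = j} : Finset V) ∈ completeEdges V r := by
  have h0 := h fun S => if S ∈ completeEdges V r then 0 else 1
  rw [sum_eq_zero (s := completeEdges V r) fun e he => by simp [he]] at h0
  have := (sum_eq_zero_iff.1 ((sum_eq_zero_iff.1 h0) i (mem_univ i))) j (mem_univ j)
  by_contra hlt
  simp [hlt] at this

end Baranyai

theorem SameTraces.isEdgeDomaticPartition {V κ : Type*} [Fintype V] [DecidableEq V] [Fintype κ]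
    [DecidableEq κ] {r k : ℕ} (hr : 1 ≤ r) {g : Fin k → V → κ} (h : SameTraces r g univ) :
    IsEdgeDomaticPartition (completeEdges V r)
      fun i => univ.image fun j => ({v | g i v = j} : Finset V) := by
  refine ⟨fun i i' hii' => ?_, ?_, fun i => ⟨?_, ?_⟩⟩
  · rw [disjoint_left]
    intro e he he'
    obtain ⟨j, -, hj⟩ := mem_image.1 he
    obtain ⟨j', -, hj'⟩ := mem_image.1 he'
    have hone := h.card_filter_eq_one (hj ▸ h.mem_completeEdges i j)
    have := card_le_one.1 hone.le (i, j) (by simpa using hj) (i', j') (by simpa using hj')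
    exact hii' (Prod.ext_iff.1 this).1
  · ext e
    simp only [mem_biUnion, mem_image, mem_univ, true_and]
    constructor
    · rintro ⟨i, j, rfl⟩
      exact h.mem_completeEdges i j
    · intro he
      obtain ⟨p, hp⟩ := card_pos.1 ((h.card_filter_eq_one he).symm ▸ one_pos)
      exact ⟨p.1, p.2, (mem_filter.1 hp).2⟩
  · intro e he
    obtain ⟨j, -, rfl⟩ := mem_image.1 he
    exact h.mem_completeEdges i j
  · intro e he hei
    have hcard : #e = r := by simpa [completeEdges] using he
    obtain ⟨x, hx⟩ := card_pos.1 (by omega : 0 < #e)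
    have hmem : ({v | g i v = g i x} : Finset V) ∈
        univ.image fun j => ({v | g i v = j} : Finset V) := mem_image_of_mem _ (mem_univ _)
    exact ⟨_, hmem, fun heq => hei (heq ▸ hmem), x, by simp [hx]⟩

theorem IsEdgeDominatingSet.card_lt_card_add_one_mul {V : Type*} [Fintype V] [DecidableEq V]
    {r : ℕ} (hr : 1 ≤ r) {F : Finset (Finset V)}
    (hF : IsEdgeDominatingSet (completeEdges V r) F) : Fintype.card V < (#F + 1) * r := by
  have hle : #(F.biUnion id) ≤ #F * r := card_biUnion_le_card_mul _ _ _ fun e he =>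
    (by simpa [completeEdges] using hF.1 he : #e = r).le
  by_contra! hlt
  have hcompl : r ≤ #(F.biUnion id)ᶜ := by
    rw [card_compl]
    rw [add_mul] at hlt
    omega
  obtain ⟨e, heF, her⟩ := exists_subset_card_eq hcompl
  have hdisj : ∀ f ∈ F, ∀ x ∈ e, x ∉ f := fun f hf x hx hxf =>
    mem_compl.1 (heF hx) (mem_biUnion.2 ⟨f, hf, hxf⟩)
  obtain ⟨y, hy⟩ := card_pos.1 (by omega : 0 < #e)
  obtain ⟨f, hf, -, x, hx⟩ := hF.2 e (by simpa [completeEdges] using her)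
    fun he => hdisj e he y hy hy
  exact hdisj f hf x (mem_inter.1 hx).1 (mem_inter.1 hx).2

theorem div_dvd_choose_of_dvd {n r : ℕ} (hn : 1 ≤ n) (hr : 1 ≤ r) (hdvd : r ∣ n) :
    n / r ∣ n.choose r := by
  obtain ⟨m, rfl⟩ := hdvd
  rw [Nat.mul_div_cancel_left m hr]
  obtain ⟨N, hN⟩ : ∃ N, r * m = N + 1 := ⟨r * m - 1, by omega⟩
  obtain ⟨s, rfl⟩ : ∃ s, r = s + 1 := ⟨r - 1, by omega⟩
  have := Nat.add_one_mul_choose_eq N s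
  rw [← hN] at this
  refine ⟨N.choose s, Nat.eq_of_mul_eq_mul_left hr ?_⟩
  rw [← mul_assoc, this, mul_comm]

/-- the complete `r`-uniform hypergraph on `n` vertices with `1 ≤ r ≤ ⌊n/2⌋`
and `r ∣ n` has edge-domatic number `C(n,r)/(n/r)`. -/
theorem edge_domatic_number_complete_small_r {V : Type*} [Fintype V] [DecidableEq V]
    {r n : ℕ} (hn : Fintype.card V = n) (hr1 : 1 ≤ r) (hr : r ≤ n / 2) (hdvd : r ∣ n) :
    IsGreatest {k : ℕ | ∃ C : Fin k → Finset (Finset V),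
      IsEdgeDomaticPartition (completeEdges V r) C} (n.choose r / (n / r)) := by
  have hn1 : 1 ≤ n := by omega
  have hmul : n / r * r = n := Nat.div_mul_cancel hdvd
  have hpos : 0 < n / r := Nat.div_pos (by omega) hr1
  constructor
  · have : Nonempty (Fin (n / r)) := ⟨⟨0, hpos⟩⟩
    obtain ⟨g, hg⟩ := exists_sameTraces_univ (V := V) (ι := Fin (n.choose r / (n / r)))
      (κ := Fin (n / r)) (r := r) (by simp [hmul, hn])
      (by simp [hn, Nat.div_mul_cancel (div_dvd_choose_of_dvd hn1 hr1 hdvd)])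
    exact ⟨_, hg.isEdgeDomaticPartition hr1⟩
  · rintro k ⟨C, hdisj, hunion, hdom⟩
    rw [Nat.le_div_iff_mul_le hpos]
    have hcard : #(completeEdges V r) = n.choose r := by simp [completeEdges, hn]
    rw [← hcard, ← hunion, card_biUnion fun i _ j _ hij => hdisj i j hij]
    have hle : ∀ i ∈ (univ : Finset (Fin k)), n / r ≤ #(C i) := fun i _ => by
      have hlt := (hdom i).card_lt_card_add_one_mul hr1
      rw [hn, ← hmul] at hlt
      exact Nat.lt_add_one_iff.1 (Nat.lt_of_mul_lt_mul_right hlt)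
    simpa using card_nsmul_le_sum _ _ _ hle
end

section
/- Let H = (X,Y,E) be a complete bipartite r-uniform hypergraph with |X| = |Y| = r and r ≥ 2. Then the edge-domatic number of H equals |E|/2, i.e., ed(H) = |E|/2. -/
open Finset

theorem eq_compl_of_disjoint_of_card {V : Type*} [Fintype V] [DecidableEq V] {r : ℕ}
    (hV : Fintype.card V = 2 * r) {e f : Finset V} (he : e.card = r) (hf : f.card = r)
    (h : Disjoint e f) : e = fᶜ := by
  apply Finset.eq_of_subset_of_card_le (Finset.subset_compl_iff_disjoint_right.2 h)
  rw [Finset.card_compl]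
  omega

theorem mem_bipEdges_iff {V : Type*} [Fintype V] [DecidableEq V] {X Y : Finset V} {r : ℕ}
    (hunion : X ∪ Y = univ) {e : Finset V} :
    e ∈ bipEdges X Y r ↔ e.card = r ∧ (e ∩ X).Nonempty ∧ (e ∩ Y).Nonempty := by
  simp [bipEdges, hunion, Finset.mem_powersetCard]

theorem inter_compl_nonempty {V : Type*} [Fintype V] [DecidableEq V] {Z W e : Finset V}
    (hdisj : Disjoint Z W) (hcard : e.card = Z.card) (hW : (e ∩ W).Nonempty) :
    (eᶜ ∩ Z).Nonempty := by
  by_contra hne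
  have hsub : Z ⊆ e := fun z hz => by
    by_contra hze
    exact hne ⟨z, by simp [hz, hze]⟩
  have heq : Z = e := Finset.eq_of_subset_of_card_le hsub hcard.le
  obtain ⟨w, hw⟩ := hW
  rw [← heq] at hw
  exact Finset.disjoint_left.1 hdisj (Finset.mem_inter.1 hw).1 (Finset.mem_inter.1 hw).2

theorem compl_mem_bipEdges {V : Type*} [Fintype V] [DecidableEq V] {X Y : Finset V} {r : ℕ}
    (hdisj : Disjoint X Y) (hunion : X ∪ Y = univ) (hXr : X.card = r) (hYr : Y.card = r)
    {e : Finset V} (he : e ∈ bipEdges X Y r) : eᶜ ∈ bipEdges X Y r := by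
  rw [mem_bipEdges_iff hunion] at he ⊢
  obtain ⟨hc, hx, hy⟩ := he
  have hV : Fintype.card V = r + r := by
    rw [← Finset.card_univ, ← hunion, Finset.card_union_of_disjoint hdisj, hXr, hYr]
  refine ⟨?_, inter_compl_nonempty hdisj (hc.trans hXr.symm) hy,
    inter_compl_nonempty hdisj.symm (hc.trans hYr.symm) hx⟩
  rw [Finset.card_compl]
  omega

theorem bipEdges_nonempty {V : Type*} [Fintype V] [DecidableEq V] {X Y : Finset V} {r : ℕ}
    (hX : X.Nonempty) (hY : Y.Nonempty) (hunion : X ∪ Y = univ)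
    (hXr : X.card = r) (hr2 : 2 ≤ r) : (bipEdges X Y r).Nonempty := by
  obtain ⟨x, hx⟩ := hX
  obtain ⟨y, hy⟩ := hY
  obtain ⟨e, hsub, -, hcard⟩ := Finset.exists_subsuperset_card_eq (n := r)
    (Finset.subset_univ ({x, y} : Finset V)) (Finset.card_le_two.trans hr2)
    (hXr ▸ Finset.card_le_univ X)
  refine ⟨e, (mem_bipEdges_iff hunion).2 ⟨hcard, ⟨x, ?_⟩, ⟨y, ?_⟩⟩⟩
  · exact Finset.mem_inter.2 ⟨hsub (by simp), hx⟩
  · exact Finset.mem_inter.2 ⟨hsub (by simp), hy⟩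

theorem two_mul_card_filter_mem_of_compl_mem {V : Type*} [Fintype V] [DecidableEq V]
    {E : Finset (Finset V)} (hE : ∀ e ∈ E, eᶜ ∈ E) (x : V) :
    2 * (E.filter fun e => x ∈ e).card = E.card := by
  have h : (E.filter fun e => x ∈ e).card = (E.filter fun e => x ∉ e).card :=
    Finset.card_bij' (fun e _ => eᶜ) (fun e _ => eᶜ)
      (by intro e; simp +contextual [hE]) (by intro e; simp +contextual [hE])
      (by simp) (by simp)
  have := Finset.card_filter_add_card_filter_not (s := E) (fun e => x ∈ e)
  omega

theorem isEdgeDominatingSet_pair_compl {V : Type*} [Fintype V] [DecidableEq V] {r : ℕ}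
    (hV : Fintype.card V = 2 * r) {E : Finset (Finset V)} (hcard : ∀ e ∈ E, e.card = r)
    {e : Finset V} (he : e ∈ E) (hec : eᶜ ∈ E) : IsEdgeDominatingSet E {e, eᶜ} := by
  refine ⟨by simp [Finset.insert_subset_iff, he, hec], fun g hg hgn => ⟨e, by simp, ?_⟩⟩
  simp only [Finset.mem_insert, Finset.mem_singleton, not_or] at hgn
  refine ⟨hgn.1, ?_⟩
  rw [← Finset.not_disjoint_iff_nonempty_inter]
  exact fun h => hgn.2 (eq_compl_of_disjoint_of_card hV (hcard g hg) (hcard e he) h)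

theorem IsEdgeDominatingSet.two_le_card {V : Type*} [Fintype V] [DecidableEq V] [Nonempty V]
    {E F : Finset (Finset V)} (hE : ∀ e ∈ E, eᶜ ∈ E) (hne : E.Nonempty)
    (hF : IsEdgeDominatingSet E F) : 2 ≤ F.card := by
  obtain ⟨f, hf⟩ : F.Nonempty := by
    obtain ⟨e, he⟩ := hne
    by_cases heF : e ∈ F
    · exact ⟨e, heF⟩
    · obtain ⟨f, hf, -⟩ := hF.2 e he heF
      exact ⟨f, hf⟩
  suffices ∃ g ∈ F, g ≠ f by
    obtain ⟨g, hg, hgf⟩ := this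
    exact Finset.one_lt_card.2 ⟨g, hg, f, hf, hgf⟩
  by_cases hfc : fᶜ ∈ F
  · exact ⟨fᶜ, hfc, compl_ne_self⟩
  · obtain ⟨g, hg, -, hint⟩ := hF.2 _ (hE f (hF.1 hf)) hfc
    refine ⟨g, hg, ?_⟩
    rintro rfl
    exact Finset.not_disjoint_iff_nonempty_inter.2 hint disjoint_compl_left

/-- a complete bipartite `r`-uniform hypergraph with `|X| = |Y| = r`, `r ≥ 2`,
has edge-domatic number `|E|/2`. -/
theorem edge_domatic_number_bipartite_balanced {V : Type*} [Fintype V] [DecidableEq V]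
    {X Y : Finset V} {r : ℕ}
    (hdisj : Disjoint X Y) (hX : X.Nonempty) (hY : Y.Nonempty)
    (hunion : X ∪ Y = (Finset.univ : Finset V))
    (hXr : X.card = r) (hYr : Y.card = r) (hr2 : 2 ≤ r) :
    IsGreatest {k : ℕ | ∃ C : Fin k → Finset (Finset V),
      IsEdgeDomaticPartition (bipEdges X Y r) C} ((bipEdges X Y r).card / 2) := by
  have hV : Fintype.card V = 2 * r := by
    rw [← Finset.card_univ, ← hunion, Finset.card_union_of_disjoint hdisj, hXr, hYr, two_mul]
  have hE : ∀ e ∈ bipEdges X Y r, eᶜ ∈ bipEdges X Y r := fun e he =>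
    compl_mem_bipEdges hdisj hunion hXr hYr he
  have hcard : ∀ e ∈ bipEdges X Y r, e.card = r := fun e he =>
    ((mem_bipEdges_iff hunion).1 he).1
  have hne : (bipEdges X Y r).Nonempty := bipEdges_nonempty hX hY hunion hXr hr2
  obtain ⟨x, -⟩ := hX
  generalize bipEdges X Y r = E at *
  constructor
  · have hA : (E.filter fun e => x ∈ e).card = E.card / 2 := by
      have := two_mul_card_filter_mem_of_compl_mem hE x
      omega
    let a := (Finset.equivFinOfCardEq hA).symm
    have ha : ∀ i, (a i : Finset V) ∈ E ∧ x ∈ (a i : Finset V) := fun i =>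
      Finset.mem_filter.1 (a i).2
    refine ⟨fun i => {(a i : Finset V), (a i : Finset V)ᶜ}, ?_, ?_, fun i =>
      isEdgeDominatingSet_pair_compl hV hcard (ha i).1 (hE _ (ha i).1)⟩
    · intro i j hij
      have hne : (a i : Finset V) ≠ a j := fun h => hij (a.injective (Subtype.ext h))
      have hnc : ∀ i j, (a i : Finset V) ≠ (a j : Finset V)ᶜ := fun i j h =>
        Finset.mem_compl.1 (h ▸ (ha i).2) (ha j).2
      simp [hne.symm, hnc j i, (hnc i j).symm]
    · ext e
      simp only [Finset.mem_biUnion, Finset.mem_univ, true_and, Finset.mem_insert,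
        Finset.mem_singleton]
      constructor
      · rintro ⟨i, rfl | rfl⟩
        exacts [(ha i).1, hE _ (ha i).1]
      · intro he
        by_cases hx : x ∈ e
        · exact ⟨a.symm ⟨e, Finset.mem_filter.2 ⟨he, hx⟩⟩, Or.inl (by simp)⟩
        · exact ⟨a.symm ⟨eᶜ, Finset.mem_filter.2 ⟨hE e he, Finset.mem_compl.2 hx⟩⟩,
            Or.inr (by simp)⟩
  · rintro k ⟨C, hC, hU, hD⟩
    have : Nonempty V := ⟨x⟩
    have hsum : E.card = ∑ i, (C i).card := by
      rw [← hU]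
      exact Finset.card_biUnion fun i _ j _ hij => hC i j hij
    have hle : ∑ _i : Fin k, 2 ≤ ∑ i, (C i).card :=
      Finset.sum_le_sum fun i _ => (hD i).two_le_card hE hne
    simp only [Finset.sum_const, Finset.card_univ, Fintype.card_fin, smul_eq_mul] at hle
    omega
end

section
/- Let H = (X,Y,E) be a complete bipartite r-uniform hypergraph with |X| = |Y| = k·r, where r ≥ 2 and k ≥ 1 is an integer. Then the edge-domatic number of H is at least |E|/(2k), i.e., ed(H) ≥ |E|/(2k). -/
open Finset

section Baranyai

open Classical in
/-- A fractional selection of one slot per group, with weights depending only on the state of the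
slot, can be rounded to an integral selection having prescribed state counts. -/
theorem exists_selection_of_weights {J K S B : Type*} [Fintype J] [Fintype K]
    (st : J → K → S) (E R : Finset B) (stE : B → S) (hRE : R ⊆ E) (w : S → ℕ) (u : ℕ)
    (hu : 0 < u)
    (hcount : ∀ σ, #{x : J × K | st x.1 x.2 = σ} = #{e ∈ E | stE e = σ})
    (hw : ∀ σ, u * #{e ∈ R | stE e = σ} = w σ * #{e ∈ E | stE e = σ})
    (hsum : ∀ j, ∑ s, w (st j s) = u) :
    ∃ s : J → K, ∀ σ, #{j | st j (s j) = σ} = #{e ∈ R | stE e = σ} := by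
  have hall : ∀ A : Finset J,
      #A ≤ #(A.biUnion fun j => {e ∈ R | ∃ s, st j s = stE e}) := by
    intro A
    refine Nat.le_of_mul_le_mul_left ?_ hu
    set T : Finset S := (A ×ˢ (univ : Finset K)).image fun x => st x.1 x.2 with hT
    calc u * #A = ∑ j ∈ A, ∑ s, w (st j s) := by simp [hsum, mul_comm]
      _ = ∑ x ∈ A ×ˢ (univ : Finset K), w (st x.1 x.2) := by rw [sum_product]
      _ = ∑ σ ∈ T, ∑ x ∈ A ×ˢ (univ : Finset K) with st x.1 x.2 = σ, w (st x.1 x.2) :=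
          (sum_fiberwise_of_maps_to (fun x hx => mem_image_of_mem _ hx) _).symm
      _ = ∑ σ ∈ T, w σ * #{x ∈ A ×ˢ (univ : Finset K) | st x.1 x.2 = σ} := by
          refine sum_congr rfl fun σ _ => ?_
          rw [sum_congr rfl (g := fun _ => w σ) (by simp +contextual)]
          simp [mul_comm]
      _ ≤ ∑ σ ∈ T, w σ * #{x : J × K | st x.1 x.2 = σ} := by
          gcongr
          exact subset_univ _
      _ = u * ∑ σ ∈ T, #{e ∈ R | stE e = σ} := by
          rw [mul_sum]
          exact sum_congr rfl fun σ _ => by rw [hcount, hw]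
      _ = u * #{e ∈ R | stE e ∈ T} := by
          rw [card_eq_sum_card_fiberwise (s := {e ∈ R | stE e ∈ T}) (t := T) (f := stE)
            (fun e he => (mem_filter.1 he).2)]
          congr 1
          refine sum_congr rfl fun σ hσ => ?_
          congr 1
          ext e
          simp only [mem_filter]
          grind
      _ ≤ _ := by
          gcongr
          intro e he
          simp only [hT, mem_filter, mem_image, mem_product, mem_univ, and_true, mem_biUnion,
            Prod.exists] at he ⊢
          grind
  obtain ⟨f, hf, hft⟩ := (all_card_le_biUnion_card_iff_exists_injective _).1 hall
  have hR : #R ≤ Fintype.card J := by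
    refine Nat.le_of_mul_le_mul_left ?_ hu
    refine le_of_eq ?_
    calc u * #R = ∑ σ ∈ E.image stE, u * #{e ∈ R | stE e = σ} := by
          rw [← mul_sum, card_eq_sum_card_fiberwise (f := stE) (t := E.image stE)
            fun e he => mem_coe.2 (mem_image_of_mem _ (hRE he))]
      _ = ∑ σ ∈ E.image stE, w σ * #{x : J × K | st x.1 x.2 = σ} :=
          sum_congr rfl fun σ _ => by rw [hcount, hw]
      _ = ∑ σ ∈ E.image stE, ∑ x : J × K with st x.1 x.2 = σ, w (st x.1 x.2) := by
          refine sum_congr rfl fun σ _ => ?_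
          rw [sum_congr rfl (g := fun _ => w σ) (by simp +contextual)]
          simp [mul_comm]
      _ = ∑ x : J × K, w (st x.1 x.2) := by
          refine sum_fiberwise_of_maps_to (fun x _ => ?_) _
          have : 0 < #{e ∈ E | stE e = st x.1 x.2} := by
            rw [← hcount]
            exact card_pos.2 ⟨x, by simp⟩
          obtain ⟨e, he⟩ := card_pos.1 this
          rw [mem_filter] at he
          exact mem_image.2 ⟨e, he⟩
      _ = u * Fintype.card J := by
          rw [Fintype.sum_prod_type]
          simp [hsum, mul_comm]
  have himg : univ.image f = R := by
    refine eq_of_subset_of_card_le (fun e he => ?_) ?_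
    · obtain ⟨j, -, rfl⟩ := mem_image.1 he
      exact (mem_filter.1 (hft j)).1
    · rwa [card_image_of_injective _ hf, card_univ]
  choose s hs using fun j => (mem_filter.1 (hft j)).2
  refine ⟨s, fun σ => ?_⟩
  rw [← himg, filter_image, card_image_of_injective _ hf]
  simp [hs]

variable {V ι : Type*} [DecidableEq V] [DecidableEq ι]

/-- The number of vertices of `e` in each class of the vertex colouring `cls`. -/
def classProfile (cls : V → ι) (e : Finset V) (i : ι) : ℕ := #{w ∈ e | cls w = i}

theorem classProfile_map_swap (cls : V → ι) {v w : V} (h : cls v = cls w) (e : Finset V) :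
    classProfile cls (e.map (Equiv.swap v w).toEmbedding) = classProfile cls e := by
  funext i
  unfold classProfile
  rw [filter_map, card_map]
  congr 1
  refine filter_congr fun x _ => ?_
  simp only [Function.comp, Equiv.coe_toEmbedding, Equiv.swap_apply_def]
  grind

theorem map_swap_inter {P : Finset V} {v w : V} (hv : v ∉ P) (hw : w ∉ P) (e : Finset V) :
    e.map (Equiv.swap v w).toEmbedding ∩ P = e ∩ P := by
  ext x
  simp only [mem_inter, mem_map_equiv, Equiv.symm_swap, Equiv.swap_apply_def]
  grind

open Classical in
/-- Double counting: among the members of a class-invariant family with given profile and given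
trace on `P`, the proportion containing a vertex outside `P` depends only on its class. -/
theorem card_mul_card_filter_mem [Fintype V] (cls : V → ι) (E : Finset (Finset V))
    (hE : ∀ e e', classProfile cls e = classProfile cls e' → e ∈ E → e' ∈ E)
    {P : Finset V} {v : V} (hv : v ∉ P) (τ : ι → ℕ) (S : Finset V) :
    #{w | w ∉ P ∧ cls w = cls v} * #{e ∈ E | v ∈ e ∧ classProfile cls e = τ ∧ e ∩ P = S} =
      (τ (cls v) - #{w ∈ S | cls w = cls v}) *
        #{e ∈ E | classProfile cls e = τ ∧ e ∩ P = S} := by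
  set U : Finset V := {w | w ∉ P ∧ cls w = cls v} with hU
  set F : Finset (Finset V) := {e ∈ E | classProfile cls e = τ ∧ e ∩ P = S} with hF
  have hswap : ∀ w ∈ U, #{e ∈ F | w ∈ e} =
      #{e ∈ E | v ∈ e ∧ classProfile cls e = τ ∧ e ∩ P = S} := by
    intro w hw
    obtain ⟨hwP, hwc⟩ : w ∉ P ∧ cls w = cls v := by simpa [hU] using hw
    refine card_nbij' (fun e => e.map (Equiv.swap v w).toEmbedding)
      (fun e => e.map (Equiv.swap v w).toEmbedding) ?_ ?_ ?_ ?_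
    · intro e he
      simp only [hF, coe_filter, mem_filter, Set.mem_ofPred_eq] at he ⊢
      rw [classProfile_map_swap cls hwc.symm, map_swap_inter hv hwP]
      refine ⟨hE e _ (classProfile_map_swap cls hwc.symm e).symm he.1.1, ?_, he.1.2⟩
      simpa [mem_map_equiv] using he.2
    · intro e he
      simp only [hF, coe_filter, mem_filter, Set.mem_ofPred_eq] at he ⊢
      rw [classProfile_map_swap cls hwc.symm, map_swap_inter hv hwP]
      refine ⟨⟨hE e _ (classProfile_map_swap cls hwc.symm e).symm he.1, he.2.2⟩, ?_⟩
      simpa [mem_map_equiv] using he.2.1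
    · intro e _
      ext x
      simp [mem_map_equiv]
    · intro e _
      ext x
      simp [mem_map_equiv]
  calc #U * _ = ∑ w ∈ U, #{e ∈ F | w ∈ e} := by rw [sum_congr rfl hswap]; simp
    _ = ∑ e ∈ F, #{w ∈ U | w ∈ e} :=
        sum_card_bipartiteAbove_eq_sum_card_bipartiteBelow (fun w e => w ∈ e)
    _ = ∑ e ∈ F, (τ (cls v) - #{w ∈ S | cls w = cls v}) := by
        refine sum_congr rfl fun e he => ?_
        obtain ⟨-, rfl, rfl⟩ := mem_filter.1 he
        rw [classProfile, ← card_sdiff_of_subset]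
        · congr 1
          ext x
          simp only [hU, mem_filter, mem_univ, mem_sdiff, mem_inter]
          grind
        · exact filter_subset_filter _ inter_subset_left
    _ = _ := by simp [mul_comm]

open Classical in
/-- **Baranyai's theorem** for families invariant under permutations preserving a colouring of the
vertices, in its inductive form: each group `j` carries a partition of the vertices into parts
`{w | c j w = s}`, and the traces on `P` of these parts are distributed like those of `E`. -/
theorem exists_parts_with_trace_counts {J K : Type*} [Fintype V] [Fintype J] [Fintype K]
    [Nonempty K]
    (cls : V → ι) (E : Finset (Finset V))
    (hE : ∀ e e', classProfile cls e = classProfile cls e' → e ∈ E → e' ∈ E)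
    (π : J → K → ι → ℕ) (hπ : ∀ j i, ∑ s, π j s i = #{w | cls w = i})
    (hcount : ∀ τ, #{x : J × K | π x.1 x.2 = τ} = #{e ∈ E | classProfile cls e = τ})
    (P : Finset V) :
    ∃ c : J → V → K, ∀ τ S,
      #{x : J × K | π x.1 x.2 = τ ∧ {w ∈ P | c x.1 w = x.2} = S} =
        #{e ∈ E | classProfile cls e = τ ∧ e ∩ P = S} := by
  induction P using Finset.induction_on with
  | empty =>
    refine ⟨fun _ _ => Classical.arbitrary K, fun τ S => ?_⟩
    by_cases hS : ∅ = S
    · simpa [← hS] using hcount τ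
    · simp [hS]
  | insert v P hv ih =>
    obtain ⟨c, hc⟩ := ih
    have hvU : v ∈ ({w | w ∉ P ∧ cls w = cls v} : Finset V) := by simp [hv]
    obtain ⟨s, hs⟩ := exists_selection_of_weights
      (fun j k => (π j k, {w ∈ P | c j w = k})) E {e ∈ E | v ∈ e}
      (fun e => (classProfile cls e, e ∩ P)) (filter_subset _ _)
      (fun σ => σ.1 (cls v) - #{w ∈ σ.2 | cls w = cls v})
      #{w | w ∉ P ∧ cls w = cls v} (card_pos.2 ⟨v, hvU⟩)
      (fun σ => by
        obtain ⟨τ, S⟩ := σ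
        simpa only [Prod.mk.injEq] using hc τ S)
      (fun σ => by
        obtain ⟨τ, S⟩ := σ
        simpa only [Prod.mk.injEq, filter_filter] using
          card_mul_card_filter_mem cls E hE hv τ S)
      (fun j => by
        have hle : ∀ k, #{w ∈ {w ∈ P | c j w = k} | cls w = cls v} ≤ π j k (cls v) := by
          intro k
          have : 0 < #{e ∈ E | classProfile cls e = π j k ∧ e ∩ P = {w ∈ P | c j w = k}} := by
            rw [← hc]
            exact card_pos.2 ⟨(j, k), by simp⟩
          obtain ⟨e, he⟩ := card_pos.1 this
          obtain ⟨-, h1, h2⟩ := mem_filter.1 he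
          rw [← h1, ← h2]
          exact card_le_card (filter_subset_filter _ inter_subset_left)
        have hpart : ∑ k, #{w ∈ {w ∈ P | c j w = k} | cls w = cls v} =
            #{w ∈ P | cls w = cls v} := by
          rw [card_eq_sum_card_fiberwise (f := c j) (t := univ) (by simp)]
          refine sum_congr rfl fun k _ => ?_
          rw [filter_comm]
        have hadd : ∑ k, (π j k (cls v) - #{w ∈ {w ∈ P | c j w = k} | cls w = cls v}) +
            #{w ∈ P | cls w = cls v} = #{w | cls w = cls v} := by
          rw [← hpart, ← sum_add_distrib, ← hπ j]
          exact sum_congr rfl fun k _ => Nat.sub_add_cancel (hle k)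
        have hsplit : #{w | w ∉ P ∧ cls w = cls v} + #{w ∈ P | cls w = cls v} =
            #{w | cls w = cls v} := by
          rw [← card_union_of_disjoint]
          · congr 1
            ext x
            simp only [mem_union, mem_filter, mem_univ, true_and]
            tauto
          · rw [disjoint_left]
            simp only [mem_filter]
            tauto
        exact Nat.add_right_cancel (hadd.trans hsplit.symm))
    have hchosen : ∀ τ S,
        #{x : J × K | x.2 = s x.1 ∧ π x.1 x.2 = τ ∧ {w ∈ P | c x.1 w = x.2} = S} =
          #{e ∈ E | v ∈ e ∧ classProfile cls e = τ ∧ e ∩ P = S} := by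
      intro τ S
      have h := hs (τ, S)
      simp only [Prod.mk.injEq, filter_filter] at h
      rw [← h]
      refine card_nbij' (fun x => x.1) (fun j => (j, s j)) ?_ ?_ ?_ ?_
      · rintro ⟨j, k⟩ h
        simp only [coe_filter, mem_univ, true_and, Set.mem_ofPred_eq] at h ⊢
        obtain ⟨rfl, h⟩ := h
        exact h
      · intro j h
        simpa using h
      · rintro ⟨j, k⟩ h
        simp only [coe_filter, mem_univ, true_and, Set.mem_ofPred_eq] at h
        rw [h.1]
      · intro j _
        rfl
    have hrest : ∀ τ S,
        #{x : J × K | x.2 ≠ s x.1 ∧ π x.1 x.2 = τ ∧ {w ∈ P | c x.1 w = x.2} = S} =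
          #{e ∈ E | v ∉ e ∧ classProfile cls e = τ ∧ e ∩ P = S} := by
      intro τ S
      have h1 := card_filter_add_card_filter_not
        (s := ({x : J × K | π x.1 x.2 = τ ∧ {w ∈ P | c x.1 w = x.2} = S} : Finset (J × K)))
        (fun x => x.2 = s x.1)
      have h2 := card_filter_add_card_filter_not
        (s := {e ∈ E | classProfile cls e = τ ∧ e ∩ P = S}) (fun e => v ∈ e)
      have h3 := hchosen τ S
      rw [hc] at h1
      simp only [filter_filter, and_comm, and_left_comm, ne_eq] at h1 h2 h3 ⊢
      omega
    refine ⟨fun j => Function.update (c j) v (s j), fun τ S => ?_⟩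
    have hfib : ∀ j k, {w ∈ insert v P | Function.update (c j) v (s j) w = k} =
        if k = s j then insert v {w ∈ P | c j w = k} else {w ∈ P | c j w = k} := by
      intro j k
      ext x
      split_ifs with h <;> simp only [mem_filter, mem_insert, Function.update_apply] <;> grind
    simp only [hfib]
    by_cases hvS : v ∈ S
    · convert hchosen τ (S.erase v) using 2
      · ext x
        simp only [mem_filter, mem_univ, true_and]
        have : v ∉ ({w ∈ P | c x.1 w = x.2} : Finset V) := by simp [hv]
        generalize ({w ∈ P | c x.1 w = x.2} : Finset V) = F at *
        split_ifs with h
        · have : insert v F = S ↔ F = S.erase v := by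
            constructor
            · rintro rfl; simp [this]
            · rintro rfl; simp [hvS]
          simp [h, this]
        · simp only [h, false_and, iff_false, not_and]
          rintro - rfl
          exact this hvS
      · ext e
        simp only [mem_filter]
        by_cases h : v ∈ e
        · have : e ∩ insert v P = S ↔ e ∩ P = S.erase v := by
            rw [inter_insert_of_mem h]
            constructor
            · rintro rfl; simp [hv]
            · intro h'; rw [h', insert_erase hvS]
          simp only [h, this, true_and]
        · have : e ∩ insert v P ≠ S := by rintro rfl; simp [h] at hvS
          simp only [h, this, and_false, false_and]
    · convert hrest τ S using 2
      · ext x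
        simp only [mem_filter, mem_univ, true_and]
        split_ifs with h
        · have : insert v ({w ∈ P | c x.1 w = x.2} : Finset V) ≠ S := by
            intro h'; exact hvS (h' ▸ mem_insert_self _ _)
          exact iff_of_false (fun h' => this h'.2) (fun h' => h'.1 h)
        · simp [h]
      · ext e
        simp only [mem_filter]
        by_cases h : v ∈ e
        · have : e ∩ insert v P ≠ S := by rintro rfl; simp [h] at hvS
          simp only [h, this, not_true_eq_false, and_false, false_and]
        · simp [h, inter_insert_of_notMem]

open Classical in
/-- A class-invariant family whose profiles can be arranged into groups, each using every vertex
class exactly up, can be partitioned into perfect matchings, one for each group. -/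
theorem exists_partition_into_perfect_matchings {J K : Type*} [Fintype V] [Fintype J] [Fintype K]
    [Nonempty K] (cls : V → ι) (E : Finset (Finset V))
    (hE : ∀ e e', classProfile cls e = classProfile cls e' → e ∈ E → e' ∈ E)
    (π : J → K → ι → ℕ) (hπ : ∀ j i, ∑ s, π j s i = #{w | cls w = i})
    (hcount : ∀ τ, #{x : J × K | π x.1 x.2 = τ} = #{e ∈ E | classProfile cls e = τ}) :
    ∃ M : J → Finset (Finset V), (∀ i j, i ≠ j → Disjoint (M i) (M j)) ∧
      univ.biUnion M = E ∧ (∀ j w, ∃ e ∈ M j, w ∈ e) ∧ ∀ j, #(M j) ≤ Fintype.card K := by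
  obtain ⟨c, hc⟩ := exists_parts_with_trace_counts cls E hE π hπ hcount univ
  simp only [inter_univ] at hc
  have hmem : ∀ j k, ({w | c j w = k} : Finset V) ∈ E ∧
      classProfile cls ({w | c j w = k} : Finset V) = π j k := by
    intro j k
    have : 0 < #{e ∈ E | classProfile cls e = π j k ∧ e = ({w | c j w = k} : Finset V)} := by
      rw [← hc]
      exact card_pos.2 ⟨(j, k), by simp⟩
    obtain ⟨e, he⟩ := card_pos.1 this
    obtain ⟨h1, h2, rfl⟩ := mem_filter.1 he
    exact ⟨h1, h2⟩
  refine ⟨fun j => univ.image fun k => ({w | c j w = k} : Finset V), ?_, ?_, ?_, fun j => card_image_le⟩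
  · intro i j hij
    rw [disjoint_left]
    rintro e hi hj
    obtain ⟨k, -, rfl⟩ := mem_image.1 hi
    obtain ⟨l, -, h⟩ := mem_image.1 hj
    have hone : #{x : J × K | π x.1 x.2 = π i k ∧
        ({w | c x.1 w = x.2} : Finset V) = ({w | c i w = k} : Finset V)} ≤ 1 := by
      rw [hc, card_le_one]
      simp +contextual
    have := card_le_one.1 hone (i, k) (by simp) (j, l) (by
      simp only [mem_filter, mem_univ, true_and]
      exact ⟨by rw [← (hmem j l).2, h, (hmem i k).2], h⟩)
    exact hij (congrArg Prod.fst this)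
  · ext e
    simp only [mem_biUnion, mem_univ, true_and, mem_image]
    constructor
    · rintro ⟨j, k, rfl⟩
      exact (hmem j k).1
    · intro he
      have : 0 < #{x : J × K | π x.1 x.2 = classProfile cls e ∧
          ({w | c x.1 w = x.2} : Finset V) = e} := by
        rw [hc]
        exact card_pos.2 ⟨e, by simp [he]⟩
      obtain ⟨x, hx⟩ := card_pos.1 this
      exact ⟨x.1, x.2, (mem_filter.1 hx).2.2⟩
  · intro j w
    exact ⟨_, mem_image_of_mem _ (mem_univ (c j w)), by simp⟩

end Baranyai

/-- The number of edges with `a` vertices in `X` and `b` in `Y`. -/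
theorem card_filter_inter_card {V : Type*} [Fintype V] [DecidableEq V] {X Y : Finset V}
    (hdisj : Disjoint X Y) (hunion : X ∪ Y = univ) (a b : ℕ) :
    #{e : Finset V | #(e ∩ X) = a ∧ #(e ∩ Y) = b} = (#X).choose a * (#Y).choose b := by
  rw [← card_powersetCard, ← card_powersetCard, ← card_product]
  have hd : ∀ x, x ∈ X → x ∉ Y := fun x hx => disjoint_left.1 hdisj hx
  refine card_nbij' (fun e => (e ∩ X, e ∩ Y)) (fun p => p.1 ∪ p.2) ?_ ?_ ?_ ?_
  · intro e he
    simp only [coe_filter, mem_univ, true_and, Set.mem_ofPred_eq] at he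
    simp [mem_powersetCard, inter_subset_right, he]
  · rintro ⟨A, B⟩ h
    simp only [coe_product, Set.mem_prod, mem_coe, mem_powersetCard] at h
    obtain ⟨⟨hA, rfl⟩, hB, rfl⟩ := h
    simp only [coe_filter, mem_univ, true_and, Set.mem_ofPred_eq]
    constructor <;> congr 1 <;> ext x <;> simp only [mem_inter, mem_union] <;> grind
  · intro e _
    simp only
    rw [← inter_union_distrib_left, hunion, inter_univ]
  · rintro ⟨A, B⟩ h
    simp only [coe_product, Set.mem_prod, mem_coe, mem_powersetCard] at h
    obtain ⟨⟨hA, -⟩, hB, -⟩ := h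
    simp only [Prod.mk.injEq]
    constructor <;> ext x <;> simp only [mem_inter, mem_union] <;> grind

theorem dvd_mul_choose (n a : ℕ) : n ∣ a * n.choose a := by
  rcases n with _ | n
  · rcases a with _ | a <;> simp
  · rcases a with _ | a
    · simp
    · exact ⟨n.choose a, by rw [Nat.add_one_mul_choose_eq, mul_comm]⟩

theorem dvd_choose_mul_choose {k r a b : ℕ} (hr : 0 < r) (hab : a + b = r) :
    k ∣ (k * r).choose a * (k * r).choose b := by
  refine Nat.dvd_of_mul_dvd_mul_right hr ?_
  have h1 : k * r ∣ a * ((k * r).choose a * (k * r).choose b) := by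
    rw [← mul_assoc]
    exact (dvd_mul_choose _ _).mul_right _
  have h2 : k * r ∣ b * ((k * r).choose a * (k * r).choose b) := by
    rw [mul_left_comm]
    exact (dvd_mul_choose _ _).mul_left _
  have h := dvd_add h1 h2
  rwa [← add_mul, hab, mul_comm r] at h

theorem two_mul_dvd_choose {k a : ℕ} (ha : 0 < a) : 2 * k ∣ (k * (a + a)).choose a := by
  refine Nat.dvd_of_mul_dvd_mul_left ha ?_
  convert dvd_mul_choose (k * (a + a)) a using 1
  ring

/-- Multiplicities of the types of perfect matchings whose `2 * k` edges have, in equal number,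
`a` and `r - a` vertices in the first part. -/
theorem exists_matching_multiplicities (k r : ℕ) :
    ∃ m : ℕ → ℕ, (∀ a, m a ≠ 0 → 0 < a ∧ a < r) ∧ ∀ a, 0 < a → a < r →
      k * (m a + m (r - a)) = (k * r).choose a * (k * r).choose (r - a) := by
  refine ⟨fun a => if 0 < a ∧ a < r then
    if 2 * a < r then (k * r).choose a * (k * r).choose (r - a) / k
    else if 2 * a = r then (k * r).choose a * (k * r).choose (r - a) / (2 * k) else 0
    else 0, fun a h => by by_contra h'; simp [h'] at h, fun a h0 hr => ?_⟩
  have hsub : r - (r - a) = a := by omega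
  have hdvd := dvd_choose_mul_choose (k := k) (a := a) (b := r - a) (h0.trans hr) (by omega)
  beta_reduce
  rw [if_pos ⟨h0, hr⟩, if_pos (by omega : 0 < r - a ∧ r - a < r), hsub]
  rcases lt_trichotomy (2 * a) r with h | h | h
  · rw [if_pos h, if_neg (by omega), if_neg (by omega), add_zero, Nat.mul_div_cancel' hdvd]
  · obtain rfl : r = a + a := by omega
    have h2 : 2 * k ∣ (k * (a + a)).choose a * (k * (a + a)).choose a :=
      (two_mul_dvd_choose h0).mul_right _
    simp only [Nat.add_sub_cancel, if_neg h.not_lt, if_pos h]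
    rw [← two_mul, ← mul_assoc, mul_comm k, Nat.mul_div_cancel' h2]
  · rw [if_neg (by omega), if_neg (by omega), if_pos (by omega), zero_add,
      mul_comm ((k * r).choose (r - a)), Nat.mul_div_cancel' hdvd]

/-- a complete bipartite `r`-uniform hypergraph with `|X| = |Y| = k·r`
(`r ≥ 2`, `k ≥ 1`) has edge-domatic number at least `|E|/(2k)`. -/
theorem edge_domatic_number_bipartite_kr {V : Type*} [Fintype V] [DecidableEq V]
    {X Y : Finset V} {r k : ℕ}
    (hdisj : Disjoint X Y) (hX : X.Nonempty) (hY : Y.Nonempty)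
    (hunion : X ∪ Y = (Finset.univ : Finset V))
    (hXc : X.card = k * r) (hYc : Y.card = k * r) (hr2 : 2 ≤ r) (hk1 : 1 ≤ k) :
    ∃ j : ℕ, (bipEdges X Y r).card / (2 * k) ≤ j ∧
      ∃ C : Fin j → Finset (Finset V), IsEdgeDomaticPartition (bipEdges X Y r) C := by
  obtain ⟨m, hm0, hm⟩ := exists_matching_multiplicities k r
  have : NeZero k := ⟨by omega⟩
  set E := bipEdges X Y r with hE
  set cls : V → Bool := fun w => decide (w ∈ X) with hcls
  have hnX : ∀ w, w ∉ X ↔ w ∈ Y := fun w => by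
    have h1 : w ∈ X ∪ Y := hunion ▸ mem_univ w
    have h2 : w ∈ X → w ∉ Y := fun hx => disjoint_left.1 hdisj hx
    rw [mem_union] at h1
    tauto
  have hprof : ∀ e, classProfile cls e = fun i => if i then #(e ∩ X) else #(e ∩ Y) := by
    intro e
    funext i
    cases i
    · simp [classProfile, hcls, hnX, filter_mem_eq_inter]
    · simp [classProfile, hcls, filter_mem_eq_inter]
  have hclass : ∀ i, #{w | cls w = i} = k * r := by
    intro i
    have := congrFun (hprof univ) i
    rw [classProfile] at this
    rw [this]
    cases i <;> simp [hXc, hYc]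
  have hmemE : ∀ e, e ∈ E ↔ #(e ∩ X) + #(e ∩ Y) = r ∧ 0 < #(e ∩ X) ∧ 0 < #(e ∩ Y) := by
    intro e
    have hcard : #e = #(e ∩ X) + #(e ∩ Y) := by
      rw [← card_union_of_disjoint, ← inter_union_distrib_left, hunion, inter_univ]
      exact hdisj.mono inter_subset_right inter_subset_right
    simp only [hE, bipEdges, mem_filter, mem_powersetCard, hunion, subset_univ, true_and, hcard,
      card_pos]
  set type : ℕ → Bool → ℕ := fun a i => if i then a else r - a with htype
  have htype_inj : ∀ {a b}, type a = type b ↔ a = b :=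
    ⟨fun h => by simpa [htype] using congrFun h true, fun h => h ▸ rfl⟩
  have hcountE : ∀ a, 0 < a → a < r →
      #{e ∈ E | classProfile cls e = type a} = (k * r).choose a * (k * r).choose (r - a) := by
    intro a h0 har
    have h := card_filter_inter_card hdisj hunion a (r - a)
    rw [hXc, hYc] at h
    rw [← h]
    congr 1
    ext e
    simp only [mem_filter, hmemE, hprof, htype, funext_iff, Bool.forall_bool, mem_univ, true_and]
    simp only [if_true, if_false, Bool.false_eq_true]
    omega
  let slot : (Σ a : Fin r, Fin (m a)) → Fin k × Bool → Bool → ℕ :=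
    fun j s => type (if s.2 then j.1 else r - j.1)
  have hslot : ∀ τ, #{x : (Σ a : Fin r, Fin (m a)) × (Fin k × Bool) | slot x.1 x.2 = τ} =
      #{e ∈ E | classProfile cls e = τ} := by
    intro τ
    by_cases hτ : ∃ a, 0 < a ∧ a < r ∧ τ = type a
    · obtain ⟨a, h0, har, rfl⟩ := hτ
      rw [hcountE a h0 har, ← hm a h0 har, card_filter, Fintype.sum_prod_type,
        Fintype.sum_sigma]
      simp only [slot, htype_inj, Fintype.sum_prod_type, Fintype.sum_bool, if_true,
        Bool.false_eq_true, if_false, sum_const, card_univ, Fintype.card_fin, smul_eq_mul]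
      rw [Fin.sum_univ_eq_sum_range
        (fun b => m b * (k * ((if b = a then 1 else 0) + if r - b = a then 1 else 0))) r]
      have hsub : ∀ b ∈ range r, m b * (k * ((if b = a then 1 else 0) +
          if r - b = a then 1 else 0)) =
          (if b = a then k * m b else 0) + if b = r - a then k * m b else 0 := by
        intro b hb
        have : r - b = a ↔ b = r - a := by
          rw [mem_range] at hb
          omega
        simp only [this]
        split_ifs <;> ring
      rw [sum_congr rfl hsub, sum_add_distrib, sum_ite_eq', sum_ite_eq', if_pos, if_pos, mul_add]
        <;> rw [mem_range] <;> omega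
    · rw [filter_false_of_mem, filter_false_of_mem]
      · rfl
      · intro e he h
        rw [hmemE] at he
        refine hτ ⟨#(e ∩ X), by omega, by omega, ?_⟩
        rw [← h, hprof]
        have : r - #(e ∩ X) = #(e ∩ Y) := by omega
        simp only [htype, this]
      · rintro ⟨⟨a, l⟩, i, b⟩ - h
        have := hm0 a (by have := l.2; omega)
        refine hτ ⟨if b then a else r - a, ?_, ?_, h.symm⟩ <;> split_ifs <;> omega
  obtain ⟨M, hdis, hcover, hmeet, hsize⟩ := exists_partition_into_perfect_matchings cls E
    (fun e e' h he => by
      rw [hprof, hprof] at h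
      have h1 := congrFun h true
      have h2 := congrFun h false
      simp only [if_true, if_false, Bool.false_eq_true] at h1 h2
      rw [hmemE] at he ⊢
      omega)
    slot
    (fun j i => by
      rw [hclass, Fintype.sum_prod_type]
      cases i <;> simp [slot, htype])
    (fun τ => by convert hslot τ)
  let φ := (Fintype.equivFin (Σ a : Fin r, Fin (m a))).symm
  refine ⟨Fintype.card (Σ a : Fin r, Fin (m a)), ?_, fun i => M (φ i),
    fun i j hij => hdis _ _ (φ.injective.ne hij), ?_, fun i => ⟨?_, fun e he heM => ?_⟩⟩
  · have hle := card_biUnion_le_card_mul univ M _ fun j _ => hsize j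
    rw [hcover, card_univ, Fintype.card_prod, Fintype.card_fin, Fintype.card_bool] at hle
    refine Nat.div_le_of_le_mul (hle.trans_eq ?_)
    ring
  · rw [← hcover]
    ext e
    simp only [mem_biUnion, mem_univ, true_and]
    exact φ.exists_congr_left.trans (by simp)
  · rw [← hcover]
    exact subset_biUnion_of_mem M (mem_univ _)
  · obtain ⟨w, hw⟩ := card_pos.1 ((hmemE e).1 he).2.1
    rw [mem_inter] at hw
    obtain ⟨f, hf, hwf⟩ := hmeet (φ i) w
    exact ⟨f, hf, fun h => heM (h ▸ hf), w, mem_inter.2 ⟨hw.1, hwf⟩⟩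
end

section
/- Let H = (X,Y,E) be a complete bipartite 3-uniform hypergraph with |X| = |Y| = k, where k ≥ 2 is even. Then the edge-domatic number of H equals |E|/(k/2), i.e., ed(H) = 2|E|/k. -/
open Finset

/-- The colour classes of this function on pairs are the perfect matchings of the standard
one-factorization of the complete graph on `Option (ZMod m)`, for odd `m`. -/
def pairColor {m : ℕ} (s : Finset (Option (ZMod m))) : ZMod m :=
  if none ∈ s then 2 * ∑ z ∈ s.eraseNone, z else ∑ z ∈ s.eraseNone, z

theorem exists_ne_pairColor_eq (n : ℕ) (i : ZMod (2 * n + 1)) (a : Option (ZMod (2 * n + 1))) :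
    ∃ b, b ≠ a ∧ pairColor {a, b} = i := by
  have h_cast : (2 * n + 1 : ZMod (2 * n + 1)) = 0 := by
    exact_mod_cast ZMod.natCast_self (2 * n + 1)
  have h_some (z : ZMod (2 * n + 1)) :
      Finset.eraseNone ({none, some z} : Finset (Option (ZMod (2 * n + 1)))) = {z} := by
    ext; simp [Finset.mem_eraseNone, eq_comm]
  cases a with
  | none =>
    refine ⟨some ((n + 1) * i), by simp, ?_⟩
    simp only [pairColor, h_some, Finset.mem_insert, true_or, if_true, Finset.sum_singleton]
    linear_combination i * h_cast
  | some a =>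
    by_cases h : i - a = a
    · refine ⟨none, by simp, ?_⟩
      rw [Finset.pair_comm]
      simp only [pairColor, h_some, Finset.mem_insert, true_or, if_true, Finset.sum_singleton]
      linear_combination -h
    · refine ⟨some (i - a), by simpa using h, ?_⟩
      have h_pair : Finset.eraseNone ({some a, some (i - a)} : Finset (Option (ZMod (2 * n + 1)))) =
          {a, i - a} := by
        ext; simp [Finset.mem_eraseNone]
      simp only [pairColor, h_pair]
      rw [if_neg (by simp), Finset.sum_pair (Ne.symm h)]
      ring

theorem exists_surjective_on_disjoint {V T : Type*} [DecidableEq V] [Fintype T] [Nonempty T]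
    {X Y : Finset V} (hdisj : Disjoint X Y) (hX : X.card = Fintype.card T)
    (hY : Y.card = Fintype.card T) :
    ∃ g : V → T, (∀ t, ∃ x ∈ X, g x = t) ∧ ∀ t, ∃ y ∈ Y, g y = t := by
  classical
  have eX : X ≃ T := Fintype.equivOfCardEq (by simpa using hX)
  have eY : Y ≃ T := Fintype.equivOfCardEq (by simpa using hY)
  refine ⟨fun v => if h : v ∈ X then eX ⟨v, h⟩ else if h : v ∈ Y then eY ⟨v, h⟩
    else Classical.arbitrary T, fun t => ⟨eX.symm t, (eX.symm t).2, by simp⟩,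
    fun t => ⟨eY.symm t, (eY.symm t).2, ?_⟩⟩
  have h : (eY.symm t : V) ∉ X := Finset.disjoint_right.mp hdisj (eY.symm t).2
  simp [h]

section Bipartite

variable {V : Type*} [DecidableEq V] {X Y : Finset V}

theorem bipEdges_comm (X Y : Finset V) (r : ℕ) : bipEdges X Y r = bipEdges Y X r := by
  ext e
  simp only [bipEdges, Finset.mem_filter, Finset.union_comm X Y]
  tauto

theorem card_inter_add_card_inter_of_mem_bipEdges (hdisj : Disjoint X Y) {r : ℕ}
    {e : Finset V} (he : e ∈ bipEdges X Y r) : (e ∩ X).card + (e ∩ Y).card = r := by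
  simp only [bipEdges, Finset.mem_filter, Finset.mem_powersetCard] at he
  rw [← Finset.card_union_of_disjoint
    (hdisj.mono Finset.inter_subset_right Finset.inter_subset_right),
    ← Finset.inter_union_distrib_left, Finset.inter_eq_left.mpr he.1.1, he.1.2]

theorem card_bipEdges_three (hdisj : Disjoint X Y) {k : ℕ} (hX : X.card = k) (hY : Y.card = k) :
    (bipEdges X Y 3).card = 2 * (k * k.choose 2) := by
  have h_union : Finset.powersetCard 3 (X ∪ Y) =
      (bipEdges X Y 3 ∪ Finset.powersetCard 3 X) ∪ Finset.powersetCard 3 Y := by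
    ext e
    simp only [bipEdges, Finset.mem_union, Finset.mem_filter, Finset.mem_powersetCard,
      Finset.subset_iff, Finset.Nonempty, Finset.mem_inter]
    grind
  have h_disj : Disjoint (bipEdges X Y 3) (Finset.powersetCard 3 X) := by
    refine Finset.disjoint_left.mpr fun e he h => ?_
    simp only [bipEdges, Finset.mem_filter, Finset.mem_powersetCard] at he h
    obtain ⟨y, hy⟩ := he.2.2
    rw [Finset.mem_inter] at hy
    exact Finset.disjoint_left.mp hdisj (h.1 hy.1) hy.2
  have h_disj' : Disjoint (bipEdges X Y 3 ∪ Finset.powersetCard 3 X)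
      (Finset.powersetCard 3 Y) := by
    refine Finset.disjoint_left.mpr fun e he h => ?_
    simp only [bipEdges, Finset.mem_union, Finset.mem_filter, Finset.mem_powersetCard] at he h
    obtain ⟨x, hxe, hx⟩ : ∃ x ∈ e, x ∈ X := by
      rcases he with he | he
      · obtain ⟨x, hx⟩ := he.2.1
        exact ⟨x, Finset.mem_inter.mp hx⟩
      · obtain ⟨x, hx⟩ : e.Nonempty := Finset.card_pos.mp (by omega)
        exact ⟨x, hx, he.1 hx⟩
    exact Finset.disjoint_left.mp hdisj hx (h.1 hxe)
  have h_card := congrArg Finset.card h_union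
  rw [Finset.card_union_of_disjoint h_disj', Finset.card_union_of_disjoint h_disj,
    Finset.card_powersetCard, Finset.card_powersetCard, Finset.card_powersetCard,
    Finset.card_union_of_disjoint hdisj, hX, hY, Nat.add_choose_eq] at h_card
  simp [Finset.Nat.antidiagonal_succ] at h_card
  linarith

theorem card_le_two_mul_of_subset_biUnion {F : Finset (Finset V)} (hdisj : Disjoint X Y)
    (hF : F ⊆ bipEdges X Y 3) (hY : Y ⊆ F.biUnion id) : Y.card ≤ 2 * F.card := by
  have h_sub : Y ⊆ F.biUnion (fun f => f ∩ Y) := by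
    intro y hy
    obtain ⟨f, hf, hyf⟩ := Finset.mem_biUnion.mp (hY hy)
    exact Finset.mem_biUnion.mpr ⟨f, hf, Finset.mem_inter.mpr ⟨hyf, hy⟩⟩
  rw [mul_comm]
  refine (Finset.card_le_card h_sub).trans (Finset.card_biUnion_le_card_mul _ _ _ fun f hf => ?_)
  have h_sum := card_inter_add_card_inter_of_mem_bipEdges hdisj (hF hf)
  have h_pos := Finset.card_pos.mpr (Finset.mem_filter.mp (hF hf)).2.1
  omega

theorem IsEdgeDominatingSet.half_le_card {F : Finset (Finset V)} {k : ℕ}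
    (hdisj : Disjoint X Y) (hX : X.card = k) (hY : Y.card = k) (hk2 : 2 ≤ k)
    (hF : IsEdgeDominatingSet (bipEdges X Y 3) F) : k / 2 ≤ F.card := by
  obtain ⟨hFE, hdom⟩ := hF
  by_cases hYW : Y ⊆ F.biUnion id
  · have := card_le_two_mul_of_subset_biUnion hdisj hFE hYW
    omega
  by_cases hXW : X ⊆ F.biUnion id
  · have := card_le_two_mul_of_subset_biUnion hdisj.symm (bipEdges_comm X Y 3 ▸ hFE) hXW
    omega
  obtain ⟨y, hyY, hyW⟩ := Finset.not_subset.mp hYW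
  obtain ⟨x, hxX, hxW⟩ := Finset.not_subset.mp hXW
  have h_uncovered : ((X ∪ Y) \ F.biUnion id).card ≤ 2 := by
    by_contra! h
    have h_sub : {x, y} ⊆ (X ∪ Y) \ F.biUnion id := by
      intro z hz
      simp only [Finset.mem_insert, Finset.mem_singleton] at hz
      rcases hz with rfl | rfl
      · exact Finset.mem_sdiff.mpr ⟨Finset.mem_union_left _ hxX, hxW⟩
      · exact Finset.mem_sdiff.mpr ⟨Finset.mem_union_right _ hyY, hyW⟩
    obtain ⟨e, hxye, heU, he⟩ := Finset.exists_subsuperset_card_eq h_sub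
      (Finset.card_le_two.trans (by omega)) h
    have hxe : x ∈ e := hxye (by simp)
    have hye : y ∈ e := hxye (by simp)
    have heE : e ∈ bipEdges X Y 3 := Finset.mem_filter.mpr
      ⟨Finset.mem_powersetCard.mpr ⟨heU.trans Finset.sdiff_subset, he⟩,
        ⟨x, Finset.mem_inter.mpr ⟨hxe, hxX⟩⟩, ⟨y, Finset.mem_inter.mpr ⟨hye, hyY⟩⟩⟩
    have heF : e ∉ F := fun h => hxW (Finset.mem_biUnion.mpr ⟨e, h, hxe⟩)
    obtain ⟨f, hf, -, z, hz⟩ := hdom e heE heF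
    rw [Finset.mem_inter] at hz
    exact (Finset.mem_sdiff.mp (heU hz.1)).2 (Finset.mem_biUnion.mpr ⟨f, hf, hz.2⟩)
  have h_cover : (F.biUnion id).card ≤ F.card * 3 :=
    Finset.card_biUnion_le_card_mul _ _ _ fun f hf =>
      (Finset.mem_powersetCard.mp (Finset.mem_filter.mp (hFE hf)).1).2.le
  have h_total : (X ∪ Y).card ≤ ((X ∪ Y) \ F.biUnion id).card + (F.biUnion id).card := by
    have := Finset.le_card_sdiff (F.biUnion id) (X ∪ Y)
    omega
  rw [Finset.card_union_of_disjoint hdisj] at h_total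
  omega

/-- The hyperedges in which `v` is the only vertex of its part and the other two vertices,
relabelled by `g`, form a pair of colour `i`. -/
def matchingClass {m : ℕ} (X Y : Finset V) (g : V → Option (ZMod m)) (p : V × ZMod m) :
    Finset (Finset V) :=
  (bipEdges X Y 3).filter fun e =>
    (e ∩ X = {p.1} ∨ e ∩ Y = {p.1}) ∧ pairColor ((e.erase p.1).image g) = p.2

theorem matchingClass_comm {m : ℕ} (X Y : Finset V) (g : V → Option (ZMod m)) (p : V × ZMod m) :
    matchingClass X Y g p = matchingClass Y X g p := by
  simp only [matchingClass, bipEdges_comm X Y, or_comm]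

theorem disjoint_matchingClass {m : ℕ} (hdisj : Disjoint X Y) (g : V → Option (ZMod m))
    {p q : V × ZMod m} (hpq : p ≠ q) :
    Disjoint (matchingClass X Y g p) (matchingClass X Y g q) := by
  refine Finset.disjoint_left.mpr fun e hp hq => hpq ?_
  obtain ⟨he, hp, hpc⟩ := Finset.mem_filter.mp hp
  obtain ⟨-, hq, hqc⟩ := Finset.mem_filter.mp hq
  have h_sum := card_inter_add_card_inter_of_mem_bipEdges hdisj he
  have h_fst : p.1 = q.1 := by
    rcases hp with hp | hp <;> rcases hq with hq | hq
    · exact Finset.singleton_injective (hp.symm.trans hq)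
    · simp [hp, hq] at h_sum
    · simp [hp, hq] at h_sum
    · exact Finset.singleton_injective (hp.symm.trans hq)
  exact Prod.ext h_fst (by rw [← hpc, ← hqc, h_fst])

theorem exists_mem_matchingClass {m : ℕ} (hdisj : Disjoint X Y) (g : V → Option (ZMod m))
    {e : Finset V} (he : e ∈ bipEdges X Y 3) : ∃ p, e ∈ matchingClass X Y g p := by
  have h_sum := card_inter_add_card_inter_of_mem_bipEdges hdisj he
  have h_posX := Finset.card_pos.mpr (Finset.mem_filter.mp he).2.1
  have h_posY := Finset.card_pos.mpr (Finset.mem_filter.mp he).2.2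
  obtain ⟨v, hv⟩ : ∃ v, e ∩ X = {v} ∨ e ∩ Y = {v} := by
    rw [exists_or, ← Finset.card_eq_one, ← Finset.card_eq_one]
    omega
  exact ⟨(v, pairColor ((e.erase v).image g)), Finset.mem_filter.mpr ⟨he, hv, rfl⟩⟩

theorem isEdgeDominatingSet_matchingClass_of_mem_left {n : ℕ} (hdisj : Disjoint X Y)
    {g : V → Option (ZMod (2 * n + 1))} (hg : ∀ t, ∃ y ∈ Y, g y = t)
    {p : V × ZMod (2 * n + 1)} (hp : p.1 ∈ X) :
    IsEdgeDominatingSet (bipEdges X Y 3) (matchingClass X Y g p) := by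
  refine ⟨Finset.filter_subset _ _, fun e he heC => ?_⟩
  obtain ⟨y, hy⟩ := (Finset.mem_filter.mp he).2.2
  obtain ⟨hye, hyY⟩ := Finset.mem_inter.mp hy
  obtain ⟨b, hb, hcol⟩ := exists_ne_pairColor_eq n p.2 (g y)
  obtain ⟨w, hwY, rfl⟩ := hg b
  have hwy : y ≠ w := fun h => hb (by rw [h])
  have hpY : p.1 ∉ Y := Finset.disjoint_left.mp hdisj hp
  have hyX : y ∉ X := Finset.disjoint_right.mp hdisj hyY
  have hwX : w ∉ X := Finset.disjoint_right.mp hdisj hwY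
  have hpy : p.1 ≠ y := fun h => hpY (h ▸ hyY)
  have hpw : p.1 ≠ w := fun h => hpY (h ▸ hwY)
  have h_erase : ({p.1, y, w} : Finset V).erase p.1 = {y, w} :=
    Finset.erase_insert (by simp [hpy, hpw])
  have h_mem : {p.1, y, w} ∈ matchingClass X Y g p := by
    refine Finset.mem_filter.mpr ⟨Finset.mem_filter.mpr ⟨Finset.mem_powersetCard.mpr
      ⟨?_, Finset.card_eq_three.mpr ⟨_, _, _, hpy, hpw, hwy, rfl⟩⟩,
      ⟨p.1, by simp [hp]⟩, ⟨y, by simp [hyY]⟩⟩, Or.inl ?_, ?_⟩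
    · simp [Finset.insert_subset_iff, hp, hyY, hwY]
    · ext z
      simp only [Finset.mem_inter, Finset.mem_insert, Finset.mem_singleton]
      grind
    · rw [h_erase, Finset.image_insert, Finset.image_singleton, hcol]
  exact ⟨_, h_mem, fun h => heC (h ▸ h_mem), y, by simp [hye]⟩

end Bipartite

theorem exists_isEdgeDomaticPartition_of_fintype {V L : Type*} [DecidableEq V] [Fintype L]
    {E : Finset (Finset V)} (C : L → Finset (Finset V))
    (hdisj : ∀ p q, p ≠ q → Disjoint (C p) (C q)) (hcover : ∀ e ∈ E, ∃ p, e ∈ C p)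
    (hdom : ∀ p, IsEdgeDominatingSet E (C p)) :
    ∃ D : Fin (Fintype.card L) → Finset (Finset V), IsEdgeDomaticPartition E D := by
  have φ : Fin (Fintype.card L) ≃ L := (Fintype.equivFin L).symm
  refine ⟨C ∘ φ, fun i j hij => hdisj _ _ (φ.injective.ne hij), ?_, fun i => hdom _⟩
  refine Finset.Subset.antisymm (Finset.biUnion_subset.mpr fun i _ => (hdom _).1) fun e he => ?_
  obtain ⟨p, hp⟩ := hcover e he
  exact Finset.mem_biUnion.mpr ⟨φ.symm p, Finset.mem_univ _, by simpa using hp⟩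

/-- a complete bipartite `3`-uniform hypergraph with `|X| = |Y| = k`,
`k ≥ 2` even, has edge-domatic number `|E|/(k/2)`. -/
theorem edge_domatic_number_bipartite_three_uniform {V : Type*} [Fintype V] [DecidableEq V]
    {X Y : Finset V} {k : ℕ}
    (hdisj : Disjoint X Y) (hX : X.Nonempty) (hY : Y.Nonempty)
    (hunion : X ∪ Y = (Finset.univ : Finset V))
    (hXc : X.card = k) (hYc : Y.card = k) (hk2 : 2 ≤ k) (hkeven : Even k) :
    IsGreatest {j : ℕ | ∃ C : Fin j → Finset (Finset V),
      IsEdgeDomaticPartition (bipEdges X Y 3) C} ((bipEdges X Y 3).card / (k / 2)) := by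
  constructor
  · obtain ⟨n, rfl⟩ : ∃ n, k = 2 * n + 2 := by
      obtain ⟨r, rfl⟩ := hkeven
      exact ⟨r - 1, by omega⟩
    obtain ⟨g, hgX, hgY⟩ := exists_surjective_on_disjoint
      (T := Option (ZMod (2 * n + 1))) hdisj (by simp [hXc, ZMod.card]) (by simp [hYc, ZMod.card])
    have h_partition := exists_isEdgeDomaticPartition_of_fintype (E := bipEdges X Y 3)
      (matchingClass X Y g) (fun _ _ => disjoint_matchingClass hdisj g)
      (fun _ => exists_mem_matchingClass hdisj g) fun p => by
        have hp : p.1 ∈ X ∪ Y := hunion ▸ Finset.mem_univ _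
        rcases Finset.mem_union.mp hp with hp | hp
        · exact isEdgeDominatingSet_matchingClass_of_mem_left hdisj hgY hp
        · rw [bipEdges_comm, matchingClass_comm]
          exact isEdgeDominatingSet_matchingClass_of_mem_left hdisj.symm hgX hp
    have h_card : (bipEdges X Y 3).card / ((2 * n + 2) / 2) =
        Fintype.card (V × ZMod (2 * n + 1)) := by
      have h_half : (2 * n + 2) / 2 = n + 1 := by omega
      have h_choose : (2 * n + 2).choose 2 = (n + 1) * (2 * n + 1) := by
        rw [Nat.choose_two_right]
        exact Nat.div_eq_of_eq_mul_left two_pos (by simp; ring)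
      rw [card_bipEdges_three hdisj hXc hYc, h_half, h_choose, Fintype.card_prod, ZMod.card,
        ← Finset.card_univ, ← hunion, Finset.card_union_of_disjoint hdisj, hXc, hYc]
      exact Nat.div_eq_of_eq_mul_left n.succ_pos (by ring)
    rw [h_card]
    exact h_partition
  · rintro j ⟨C, hC, hCE, hCdom⟩
    rw [Nat.le_div_iff_mul_le (by omega), ← hCE,
      Finset.card_biUnion fun i _ i' _ h => hC i i' h]
    simpa using Finset.card_nsmul_le_sum Finset.univ (fun i => (C i).card) (k / 2)
      fun i _ => (hCdom i).half_le_card hdisj hXc hYc hk2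
end

section
/- Let H = (V,E) be an r-uniform hypergraph with n vertices and m hyperedges, m ≥ 2, which has no isolated vertex (every vertex belongs to some hyperedge). If r > ⌊n/2⌋, then the total edge-domatic number of H equals ⌊m/2⌋, i.e., ed_t(H) = ⌊m/2⌋. -/
open Finset

/-- A total edge-dominating set of a nonempty family has at least two elements. -/
lemma IsTotalEdgeDominatingSet.one_lt_card {V : Type*} [DecidableEq V]
    {E F : Finset (Finset V)} (h : IsTotalEdgeDominatingSet E F) (hE : E.Nonempty) :
    1 < F.card := by
  obtain ⟨e, he⟩ := hE
  obtain ⟨f, hf, -⟩ := h.2 e he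
  obtain ⟨g, hg, hfg, -⟩ := h.2 f (h.1 hf)
  exact Finset.one_lt_card.2 ⟨f, hf, g, hg, hfg⟩

/-- In an intersecting family, every subfamily with at least two members is a total
edge-dominating set. -/
lemma isTotalEdgeDominatingSet_of_intersecting {V : Type*} [DecidableEq V]
    {E F : Finset (Finset V)} (hE : ∀ e ∈ E, ∀ f ∈ E, (e ∩ f).Nonempty)
    (hF : F ⊆ E) (hcard : 1 < F.card) : IsTotalEdgeDominatingSet E F := by
  refine ⟨hF, fun e he => ?_⟩
  obtain ⟨f, hf, hfe⟩ := Finset.exists_mem_ne hcard e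
  exact ⟨f, hf, hfe.symm, hE e he f (hF hf)⟩

/-- A finite set can be partitioned into `⌊|E| / 2⌋ ≥ 1` classes of size at least two. -/
lemma exists_partition_one_lt_card {α : Type*} [DecidableEq α] (E : Finset α)
    (hE : 2 ≤ E.card) :
    ∃ C : Fin (E.card / 2) → Finset α,
      (∀ i j, i ≠ j → Disjoint (C i) (C j)) ∧ Finset.univ.biUnion C = E ∧
        ∀ i, 1 < (C i).card := by
  let g : Fin E.card → α := fun j => (E.equivFin.symm j : α)
  have hg : Function.Injective g := Subtype.val_injective.comp E.equivFin.symm.injective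
  let c : Fin E.card → Fin (E.card / 2) := fun j =>
    ⟨min (j / 2) (E.card / 2 - 1), by omega⟩
  refine ⟨fun i => (Finset.univ.filter fun j => c j = i).image g, fun i j hij => ?_, ?_,
    fun i => ?_⟩
  · rw [Finset.disjoint_image hg, Finset.disjoint_filter]
    rintro x - rfl
    exact hij
  · ext x
    simp only [Finset.mem_biUnion, Finset.mem_univ, true_and, Finset.mem_image,
      Finset.mem_filter]
    constructor
    · rintro ⟨-, j, -, rfl⟩
      exact (E.equivFin.symm j).2
    · intro hx
      exact ⟨_, E.equivFin ⟨x, hx⟩, rfl, by simp [g]⟩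
  · rw [Finset.card_image_of_injective _ hg, Finset.one_lt_card]
    have hi := i.2
    refine ⟨⟨2 * i, by omega⟩, ?_, ⟨2 * i + 1, by omega⟩, ?_, ?_⟩
    · simp only [c, Finset.mem_filter, Finset.mem_univ, true_and, Fin.ext_iff]
      omega
    · simp only [c, Finset.mem_filter, Finset.mem_univ, true_and, Fin.ext_iff]
      omega
    · simp

/-- an `r`-uniform hypergraph with `n` vertices, `m ≥ 2` hyperedges, no
isolated vertex, and `r > ⌊n/2⌋` has total edge-domatic number `⌊m/2⌋`. -/
theorem total_edge_domatic_number_large_r {V : Type*} [Fintype V] [DecidableEq V]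
    {E : Finset (Finset V)} {r n m : ℕ}
    (hn : Fintype.card V = n) (hm : E.card = m) (hm2 : 2 ≤ m)
    (hunif : ∀ e ∈ E, e.card = r)
    (hniso : ∀ v : V, ∃ e ∈ E, v ∈ e)
    (hr : n / 2 < r) :
    IsGreatest {k : ℕ | ∃ C : Fin k → Finset (Finset V),
      IsTotalEdgeDomaticPartition E C} (m / 2) := by
  have hinter : ∀ e ∈ E, ∀ f ∈ E, (e ∩ f).Nonempty := by
    intro e he f hf
    have h₁ := Finset.card_union_add_card_inter e f
    have h₂ := Finset.card_le_univ (e ∪ f)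
    rw [hunif e he, hunif f hf] at h₁
    rw [← Finset.card_pos]
    omega
  subst hm
  constructor
  · obtain ⟨C, hdisj, hunion, hcard⟩ := exists_partition_one_lt_card E hm2
    refine ⟨C, hdisj, hunion, fun i =>
      isTotalEdgeDominatingSet_of_intersecting hinter ?_ (hcard i)⟩
    exact (Finset.subset_biUnion_of_mem C (Finset.mem_univ i)).trans_eq hunion
  · rintro k ⟨C, hdisj, hunion, hdom⟩
    have hE : E.Nonempty := Finset.card_pos.1 (by omega)
    rw [Nat.le_div_iff_mul_le two_pos]
    calc k * 2 = ∑ _i : Fin k, 2 := by simp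
      _ ≤ ∑ i, (C i).card := Finset.sum_le_sum fun i _ => (hdom i).one_lt_card hE
      _ = (Finset.univ.biUnion C).card :=
        (Finset.card_biUnion fun i _ j _ hij => hdisj i j hij).symm
      _ = E.card := by rw [hunion]
end
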